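/- arXiv:1510.08326 — 9 statements merged into one kernel-verified Lean document; each statement's English description precedes it below -/
import Mathlib

section
/- Let α ∈ ℂ and let U ⊆ ℂ be open. Suppose q, p : ℂ → ℂ are differentiable on U, satisfy the Hamiltonian system q'(z) = p(z) − q(z)² − z/2 and p'(z) = 2 q(z) p(z) + α + 1/2 for all z ∈ U, and p(z) ≠ 0 on U. Then p is twice differentiable on U and satisfies the Painlevé XXXIV equation P_34(α): p''(z) = (p'(z))²/(2 p(z)) + 2 p(z)² − z p(z) − (α + 1/2)²/(2 p(z)) for all z ∈ U. -/
/-- If `q, p` solve the Hamiltonian system associated with the second Painlevé equation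
on an open set `U` and `p` is nonvanishing on `U`, then `p` is twice differentiable on `U`
and solves the Painlevé XXXIV equation P_34(α). -/
theorem hamiltonian_system_implies_P34 (α : ℂ) (U : Set ℂ) (hU : IsOpen U)
    (q p : ℂ → ℂ)
    (hq : ∀ z ∈ U, DifferentiableAt ℂ q z)
    (hp : ∀ z ∈ U, DifferentiableAt ℂ p z)
    (hqp : ∀ z ∈ U, deriv q z = p z - q z ^ 2 - z / 2)
    (hpq : ∀ z ∈ U, deriv p z = 2 * q z * p z + α + 1 / 2)
    (hp0 : ∀ z ∈ U, p z ≠ 0) :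
    ∀ z ∈ U, DifferentiableAt ℂ (deriv p) z ∧
      deriv (deriv p) z = (deriv p z) ^ 2 / (2 * p z) + 2 * p z ^ 2 - z * p z
        - (α + 1 / 2) ^ 2 / (2 * p z) := by
  intro z hz
  have hev : deriv p =ᶠ[nhds z] fun w => 2 * q w * p w + α + 1 / 2 :=
    Filter.eventuallyEq_of_mem (hU.mem_nhds hz) hpq
  have hd : HasDerivAt (deriv p) (2 * deriv q z * p z + 2 * q z * deriv p z) z :=
    (((((hq z hz).hasDerivAt.const_mul 2).mul (hp z hz).hasDerivAt).add_const α).add_const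
      (1 / 2)).congr_of_eventuallyEq hev
  refine ⟨hd.differentiableAt, ?_⟩
  have h0 := hp0 z hz
  rw [hd.deriv, hqp z hz, hpq z hz]
  field_simp
  ring
end

section
/- Let α ∈ ℂ and let U ⊆ ℂ be open. Suppose p : ℂ → ℂ is twice differentiable on U, p(z) ≠ 0 on U, and p satisfies the Painlevé XXXIV equation P_34(α): p''(z) = (p'(z))²/(2 p(z)) + 2 p(z)² − z p(z) − (α + 1/2)²/(2 p(z)) for all z ∈ U. Then q(z) = (p'(z) − α − 1/2)/(2 p(z)) is twice differentiable on U and satisfies the second Painlevé equation P_II(α): q''(z) = 2 q(z)³ + z q(z) + α for all z ∈ U. -/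
/-- If `p` is a nonvanishing solution of the Painlevé XXXIV equation P_34(α) on an open set `U`,
then `q = (p' − α − 1/2)/(2p)` is twice differentiable on `U` and solves P_II(α). -/
theorem P34_implies_PII (α : ℂ) (U : Set ℂ) (hU : IsOpen U)
    (p : ℂ → ℂ)
    (hp : ∀ z ∈ U, DifferentiableAt ℂ p z)
    (hp' : ∀ z ∈ U, DifferentiableAt ℂ (deriv p) z)
    (hp0 : ∀ z ∈ U, p z ≠ 0)
    (hP34 : ∀ z ∈ U, deriv (deriv p) z = (deriv p z) ^ 2 / (2 * p z) + 2 * p z ^ 2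
      - z * p z - (α + 1 / 2) ^ 2 / (2 * p z))
    (q : ℂ → ℂ)
    (hqdef : ∀ z, q z = (deriv p z - α - 1 / 2) / (2 * p z)) :
    ∀ z ∈ U, DifferentiableAt ℂ q z ∧ DifferentiableAt ℂ (deriv q) z ∧
      deriv (deriv q) z = 2 * q z ^ 3 + z * q z + α := by
  have hdp : ∀ z ∈ U, deriv p z = 2 * p z * q z + α + 1 / 2 := by
    intro z hz
    have h0 := hp0 z hz
    rw [hqdef]
    field_simp
    ring
  have hqd : ∀ z ∈ U, HasDerivAt q (-q z ^ 2 + p z - z / 2) z := by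
    intro z hz
    have h0 := hp0 z hz
    have h := (((hp' z hz).hasDerivAt.sub_const α).sub_const (1 / 2)).div
      ((hp z hz).hasDerivAt.const_mul 2) (mul_ne_zero two_ne_zero h0)
    have h' := h.congr_of_eventuallyEq (.of_forall hqdef)
    refine h'.congr_deriv ?_
    rw [hP34 z hz, hdp z hz]
    field_simp
    ring
  intro z hz
  have hderiv : deriv q =ᶠ[nhds z] fun w => -q w ^ 2 + p w - w / 2 := by
    filter_upwards [hU.mem_nhds hz] with w hw using (hqd w hw).deriv
  have hdd := ((((hqd z hz).pow 2).neg.add (hp z hz).hasDerivAt).sub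
    ((hasDerivAt_id z).div_const 2)).congr_of_eventuallyEq hderiv
  refine ⟨(hqd z hz).differentiableAt, hdd.differentiableAt, ?_⟩
  rw [hdd.deriv, hdp z hz]
  push_cast
  ring
end

section
/- Let α ∈ ℂ and let U ⊆ ℂ be open. Suppose q, p : ℂ → ℂ are differentiable on U and satisfy the Hamiltonian system q'(z) = p(z) − q(z)² − z/2 and p'(z) = 2 q(z) p(z) + α + 1/2 for all z ∈ U. Define σ(z) = p(z)²/2 − (q(z)² + z/2) p(z) − (α + 1/2) q(z). Then σ is twice differentiable on U and satisfies the Jimbo–Miwa–Okamoto equation S_II(α): (σ''(z))² + 4 (σ'(z))³ + 2 σ'(z) (z σ'(z) − σ(z)) = (α + 1/2)²/4 for all z ∈ U. -/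
/-- Along a solution of the Hamiltonian system, the total derivative of the Hamiltonian is its
partial derivative `-p/2` in `z`. -/
lemma hasDerivAt_hamiltonian {α z : ℂ} {q p : ℂ → ℂ}
    (hq : HasDerivAt q (p z - q z ^ 2 - z / 2) z)
    (hp : HasDerivAt p (2 * q z * p z + α + 1 / 2) z) :
    HasDerivAt (fun w => p w ^ 2 / 2 - (q w ^ 2 + w / 2) * p w - (α + 1 / 2) * q w)
      (-p z / 2) z := by
  refine ((((hp.fun_pow 2).div_const 2).fun_sub
    (((hq.fun_pow 2).fun_add ((hasDerivAt_id' z).div_const 2)).fun_mul hp)).fun_sub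
    (hq.const_mul (α + 1 / 2))).congr_deriv ?_
  push_cast
  ring


/-- If `q, p` solve the Hamiltonian system associated with P_II(α) on an open set `U`,
then the Hamiltonian `σ = p²/2 − (q² + z/2)p − (α + 1/2)q` is twice differentiable on `U`
and solves the Jimbo–Miwa–Okamoto equation S_II(α). -/
theorem hamiltonian_satisfies_SII (α : ℂ) (U : Set ℂ) (hU : IsOpen U)
    (q p : ℂ → ℂ)
    (hq : ∀ z ∈ U, DifferentiableAt ℂ q z)
    (hp : ∀ z ∈ U, DifferentiableAt ℂ p z)
    (hqp : ∀ z ∈ U, deriv q z = p z - q z ^ 2 - z / 2)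
    (hpq : ∀ z ∈ U, deriv p z = 2 * q z * p z + α + 1 / 2)
    (σ : ℂ → ℂ)
    (hσdef : ∀ z, σ z = p z ^ 2 / 2 - (q z ^ 2 + z / 2) * p z - (α + 1 / 2) * q z) :
    ∀ z ∈ U, DifferentiableAt ℂ σ z ∧ DifferentiableAt ℂ (deriv σ) z ∧
      (deriv (deriv σ) z) ^ 2 + 4 * (deriv σ z) ^ 3
        + 2 * deriv σ z * (z * deriv σ z - σ z) = (α + 1 / 2) ^ 2 / 4 := by
  intro z hz
  have hσ' : ∀ w ∈ U, HasDerivAt σ (-p w / 2) w := fun w hw =>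
    (funext hσdef : σ = _) ▸ hasDerivAt_hamiltonian (hqp w hw ▸ (hq w hw).hasDerivAt)
      (hpq w hw ▸ (hp w hw).hasDerivAt)
  have hσ'' : HasDerivAt (deriv σ) (-(2 * q z * p z + α + 1 / 2) / 2) z := by
    have h := ((hpq z hz ▸ (hp z hz).hasDerivAt).fun_neg).div_const 2
    refine h.congr_of_eventuallyEq ?_
    filter_upwards [hU.mem_nhds hz] with w hw using (hσ' w hw).deriv
  refine ⟨(hσ' z hz).differentiableAt, hσ''.differentiableAt, ?_⟩
  rw [hσ''.deriv, (hσ' z hz).deriv, hσdef z]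
  ring
end

section
/- Let α ∈ ℂ and let U ⊆ ℂ be open. Suppose q : ℂ → ℂ is twice differentiable on U, satisfies the second Painlevé equation P_II(α): q''(z) = 2 q(z)³ + z q(z) + α for all z ∈ U, and that w(z) = 2 q(z)² + 2 q'(z) + z is nonzero on U. Then Q(z) = −q(z) − (2α + 1)/w(z) is twice differentiable on U and satisfies the second Painlevé equation P_II(α + 1): Q''(z) = 2 Q(z)³ + z Q(z) + (α + 1) for all z ∈ U. -/
/-- The Bäcklund transformation 𝒯₊: if `q` solves P_II(α) on an open set `U` and
`w = 2q² + 2q' + z` is nonvanishing on `U`, then `Q = −q − (2α + 1)/w` is twice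
differentiable on `U` and solves P_II(α + 1). -/
theorem backlund_T_plus (α : ℂ) (U : Set ℂ) (hU : IsOpen U)
    (q : ℂ → ℂ)
    (hq : ∀ z ∈ U, DifferentiableAt ℂ q z)
    (hq' : ∀ z ∈ U, DifferentiableAt ℂ (deriv q) z)
    (hPII : ∀ z ∈ U, deriv (deriv q) z = 2 * q z ^ 3 + z * q z + α)
    (w : ℂ → ℂ)
    (hwdef : ∀ z, w z = 2 * q z ^ 2 + 2 * deriv q z + z)
    (hw0 : ∀ z ∈ U, w z ≠ 0)
    (Q : ℂ → ℂ)
    (hQdef : ∀ z, Q z = -q z - (2 * α + 1) / w z) :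
    ∀ z ∈ U, DifferentiableAt ℂ Q z ∧ DifferentiableAt ℂ (deriv Q) z ∧
      deriv (deriv Q) z = 2 * Q z ^ 3 + z * Q z + (α + 1) := by
  have hq1 : ∀ z ∈ U, HasDerivAt q (deriv q z) z := fun z hz => (hq z hz).hasDerivAt
  have hq2 : ∀ z ∈ U, HasDerivAt (deriv q) (2 * q z ^ 3 + z * q z + α) z := fun z hz =>
    hPII z hz ▸ (hq' z hz).hasDerivAt
  have hw1 : ∀ z ∈ U, HasDerivAt w (2 * q z * w z + (2 * α + 1)) z := by
    intro z hz
    rw [funext hwdef]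
    refine (((((hq1 z hz).pow 2).const_mul 2).add ((hq2 z hz).const_mul 2)).add
      (hasDerivAt_id z)).congr_deriv ?_
    norm_num
    ring
  have hQ1 : ∀ z ∈ U, HasDerivAt Q
      (-deriv q z + 2 * (2 * α + 1) * (q z / w z) + (2 * α + 1) ^ 2 * (1 / w z ^ 2)) z := by
    intro z hz
    have hw := hw0 z hz
    rw [funext hQdef]
    refine ((hq1 z hz).neg.sub
      ((hasDerivAt_const z (2 * α + 1)).div (hw1 z hz) hw)).congr_deriv ?_
    field_simp
    ring
  have hQ2 : ∀ z ∈ U, HasDerivAt (deriv Q) (2 * Q z ^ 3 + z * Q z + (α + 1)) z := by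
    intro z hz
    have hw := hw0 z hz
    have heq : deriv Q =ᶠ[nhds z] fun z =>
        -deriv q z + 2 * (2 * α + 1) * (q z / w z) + (2 * α + 1) ^ 2 * (1 / w z ^ 2) :=
      Filter.eventuallyEq_of_mem (hU.mem_nhds hz) fun y hy => (hQ1 y hy).deriv
    refine HasDerivAt.congr_of_eventuallyEq ?_ heq
    refine (((hq2 z hz).neg.add
      (((hq1 z hz).div (hw1 z hz) hw).const_mul (2 * (2 * α + 1)))).add
      (((hasDerivAt_const z (1 : ℂ)).div ((hw1 z hz).pow 2)
        (pow_ne_zero 2 hw)).const_mul ((2 * α + 1) ^ 2))).congr_deriv ?_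
    have hd : deriv q z = (w z - 2 * q z ^ 2 - z) / 2 := by
      rw [hwdef z]
      ring
    rw [hQdef z, hd]
    simp only [Pi.pow_apply]
    norm_num
    field_simp
    ring
  exact fun z hz => ⟨(hQ1 z hz).differentiableAt, (hQ2 z hz).differentiableAt, (hQ2 z hz).deriv⟩
end

section
/- Let α ∈ ℂ and let U ⊆ ℂ be open. Suppose q : ℂ → ℂ is twice differentiable on U, satisfies the second Painlevé equation P_II(α): q''(z) = 2 q(z)³ + z q(z) + α for all z ∈ U, and that w(z) = 2 q(z)² − 2 q'(z) + z is nonzero on U. Then Q(z) = −q(z) − (2α − 1)/w(z) is twice differentiable on U and satisfies the second Painlevé equation P_II(α − 1): Q''(z) = 2 Q(z)³ + z Q(z) + (α − 1) for all z ∈ U. -/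
/-- The Bäcklund transformation 𝒯₋: if `q` solves P_II(α) on an open set `U` and
`w = 2q² − 2q' + z` is nonvanishing on `U`, then `Q = −q − (2α − 1)/w` is twice
differentiable on `U` and solves P_II(α − 1). -/
theorem backlund_T_minus (α : ℂ) (U : Set ℂ) (hU : IsOpen U)
    (q : ℂ → ℂ)
    (hq : ∀ z ∈ U, DifferentiableAt ℂ q z)
    (hq' : ∀ z ∈ U, DifferentiableAt ℂ (deriv q) z)
    (hPII : ∀ z ∈ U, deriv (deriv q) z = 2 * q z ^ 3 + z * q z + α)
    (w : ℂ → ℂ)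
    (hwdef : ∀ z, w z = 2 * q z ^ 2 - 2 * deriv q z + z)
    (hw0 : ∀ z ∈ U, w z ≠ 0)
    (Q : ℂ → ℂ)
    (hQdef : ∀ z, Q z = -q z - (2 * α - 1) / w z) :
    ∀ z ∈ U, DifferentiableAt ℂ Q z ∧ DifferentiableAt ℂ (deriv Q) z ∧
      deriv (deriv Q) z = 2 * Q z ^ 3 + z * Q z + (α - 1) := by
  have hw : ∀ z ∈ U, HasDerivAt w (-2 * q z * w z - (2 * α - 1)) z := by
    intro z hz
    have h := ((((hq z hz).hasDerivAt.pow 2).const_mul 2).sub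
      ((hq' z hz).hasDerivAt.const_mul 2)).add (hasDerivAt_id z)
    refine (h.congr_of_eventuallyEq (.of_forall fun x => ?_)).congr_deriv ?_
    · simp [hwdef x]
    · rw [hPII z hz, hwdef z]
      push_cast
      ring
  have hQ : ∀ z ∈ U, HasDerivAt Q
      (-deriv q z - 2 * (2 * α - 1) * (q z / w z) - (2 * α - 1) ^ 2 * (w z ^ 2)⁻¹) z := by
    intro z hz
    have hz0 := hw0 z hz
    have h := (hq z hz).hasDerivAt.neg.sub ((hasDerivAt_const z (2 * α - 1)).div (hw z hz) hz0)
    refine (h.congr_of_eventuallyEq (.of_forall fun x => ?_)).congr_deriv ?_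
    · simp [hQdef x]
    · field_simp
      ring
  intro z hz
  have hz0 := hw0 z hz
  have hQ' : HasDerivAt (deriv Q) (2 * Q z ^ 3 + z * Q z + (α - 1)) z := by
    have h := ((hq' z hz).hasDerivAt.neg.sub
      (((hq z hz).hasDerivAt.div (hw z hz) hz0).const_mul (2 * (2 * α - 1)))).sub
      ((((hw z hz).pow 2).inv (pow_ne_zero 2 hz0)).const_mul ((2 * α - 1) ^ 2))
    refine (h.congr_of_eventuallyEq ?_).congr_deriv ?_
    · filter_upwards [hU.mem_nhds hz] with x hx
      simp [(hQ x hx).deriv]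
    · have hdq : deriv q z = (2 * q z ^ 2 + z - w z) / 2 := by
        rw [hwdef z]
        ring
      rw [hPII z hz, hQdef z, hdq]
      simp only [Pi.pow_apply]
      push_cast
      field_simp
      ring
  exact ⟨(hQ z hz).differentiableAt, hQ'.differentiableAt, hQ'.deriv⟩
end

section
/- Let n ≥ 1 and let U ⊆ ℂ be open. Suppose φ : ℂ → ℂ is infinitely differentiable on U and satisfies φ''(z) + (z/2) φ(z) = 0 for all z ∈ U. For m ≥ 1 let τ_m(z) = det[φ^{(j+k)}(z)]_{j,k=0}^{m−1} (the m×m determinant whose (j,k) entry is the (j+k)-th derivative of φ), and set τ_0(z) = 1. Suppose τ_n(z) ≠ 0 and τ_{n−1}(z) ≠ 0 on U. Then q_n(z) = τ_{n−1}'(z)/τ_{n−1}(z) − τ_n'(z)/τ_n(z) satisfies the second Painlevé equation P_II(n − 1/2): q_n''(z) = 2 q_n(z)³ + z q_n(z) + (n − 1/2) for all z ∈ U. -/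
open Polynomial

theorem Derivation.map_finset_prod {A ι : Type*} [CommRing A] [DecidableEq ι]
    (D : Derivation ℤ A A) (s : Finset ι) (f : ι → A) :
    D (∏ i ∈ s, f i) = ∑ i ∈ s, (∏ j ∈ s.erase i, f j) * D (f i) := by
  induction s using Finset.induction_on with
  | empty => simp
  | insert a s ha ih =>
    rw [Finset.prod_insert ha, D.leibniz, ih, Finset.sum_insert ha, Finset.erase_insert ha,
      smul_eq_mul, smul_eq_mul, Finset.mul_sum, add_comm]
    congr 1
    refine Finset.sum_congr rfl fun i hi => ?_
    rw [Finset.erase_insert_of_ne (by rintro rfl; exact ha hi), Finset.prod_insert (by simp [ha]),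
      mul_assoc]

theorem Derivation.map_det {A n : Type*} [CommRing A] [Fintype n] [DecidableEq n]
    (D : Derivation ℤ A A) (M : Matrix n n A) :
    D M.det = ∑ c, (M.updateCol c fun i => D (M i c)).det := by
  simp only [Matrix.det_apply', map_sum, D.leibniz, D.map_intCast,
    smul_eq_mul, D.map_finset_prod, Finset.mul_sum, mul_zero, add_zero]
  rw [Finset.sum_comm]
  refine Finset.sum_congr rfl fun c _ => Finset.sum_congr rfl fun σ _ => ?_
  rw [← Finset.prod_erase_mul _ _ (Finset.mem_univ c), Matrix.updateCol_self]
  congr 2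
  refine Finset.prod_congr rfl fun j hj => ?_
  rw [Matrix.updateCol_ne (Finset.ne_of_mem_erase hj)]

section Moments

variable {A : Type*} [CommRing A]

/-- The linear functional on polynomials with moments `a k`. -/
noncomputable def momentFunctional (a : ℕ → A) : A[X] →ₗ[A] A :=
  Polynomial.lsum fun k => LinearMap.toSpanSingleton A A (a k)

/-- The `m × m` Hankel matrix of the sequence `a`. -/
def hankelMatrix (a : ℕ → A) (m : ℕ) : Matrix (Fin m) (Fin m) A :=
  Matrix.of fun j k => a (j + k)

@[simp]
theorem momentFunctional_monomial (a : ℕ → A) (k : ℕ) (c : A) :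
    momentFunctional a (monomial k c) = c * a k := by
  simp [momentFunctional, Polynomial.lsum_apply, Polynomial.sum_monomial_index]

theorem momentFunctional_C_mul (a : ℕ → A) (c : A) (p : A[X]) :
    momentFunctional a (C c * p) = c * momentFunctional a p := by
  rw [← smul_eq_C_mul, map_smul, smul_eq_mul]

theorem momentFunctional_mul_X_pow (a : ℕ → A) {m : ℕ} {S : A[X]}
    (hS : ∀ i, m ≤ i → S.coeff i = 0) (k : ℕ) :
    momentFunctional a (S * X ^ k) = ∑ i : Fin m, a (k + i) * S.coeff i := by
  have h : S = ∑ i ∈ Finset.range m, monomial i (S.coeff i) := by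
    ext j
    simp only [finsetSum_coeff, coeff_monomial]
    by_cases hj : j < m
    · simp [hj]
    · simp [hj, hS j (not_lt.1 hj)]
  conv_lhs => rw [h]
  rw [Finset.sum_mul, map_sum, Finset.sum_range]
  simp [mul_comm, add_comm]

/-- A nondegenerate Hankel matrix separates polynomials of low degree. -/
theorem eq_zero_of_momentFunctional_eq_zero {a : ℕ → A} {m : ℕ}
    (hu : IsUnit (hankelMatrix a m).det) {S : A[X]} (hS : ∀ i, m ≤ i → S.coeff i = 0)
    (h : ∀ k < m, momentFunctional a (S * X ^ k) = 0) : S = 0 := by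
  have hinj := Matrix.mulVec_injective_of_isUnit ((Matrix.isUnit_iff_isUnit_det _).2 hu)
  have hv : (fun i : Fin m => S.coeff i) = 0 := by
    apply hinj
    rw [Matrix.mulVec_zero]
    ext k
    have := h k k.2
    rwa [momentFunctional_mul_X_pow a hS] at this
  ext i
  by_cases hi : i < m
  · exact congrFun hv ⟨i, hi⟩
  · simpa using hS i (not_lt.1 hi)

theorem momentFunctional_mul_of_orthogonal {a : ℕ → A} {m : ℕ} {P S : A[X]}
    (hP : ∀ k < m, momentFunctional a (P * X ^ k) = 0) (hS : ∀ i, m < i → S.coeff i = 0) :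
    momentFunctional a (P * S) = S.coeff m * momentFunctional a (P * X ^ m) := by
  have h : S = ∑ i ∈ Finset.range (m + 1), C (S.coeff i) * X ^ i := by
    ext j
    simp only [finsetSum_coeff, coeff_C_mul_X_pow]
    by_cases hj : j < m + 1
    · simp [hj]
    · simp [hj, hS j (by omega)]
  conv_lhs => rw [h]
  rw [Finset.sum_range_succ, mul_add, Finset.mul_sum, map_add, map_sum,
    Finset.sum_eq_zero, zero_add, mul_left_comm, momentFunctional_C_mul]
  intro i hi
  rw [mul_left_comm, momentFunctional_C_mul, hP i (Finset.mem_range.1 hi), mul_zero]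

theorem momentFunctional_pearson {a : ℕ → A} {z : A}
    (hrec : ∀ k : ℕ, 2 * a (k + 2) + z * a k + k * a (k - 1) = 0) (p : A[X]) :
    momentFunctional a (derivative p) + z * momentFunctional a p
      + 2 * momentFunctional a (X ^ 2 * p) = 0 := by
  induction p using Polynomial.induction_on' with
  | add p q hp hq =>
    simp only [map_add, mul_add]
    linear_combination hp + hq
  | monomial k c =>
    rw [derivative_monomial, X_pow_mul_monomial]
    simp only [momentFunctional_monomial]
    linear_combination c * hrec k

variable [Differential A]

open Differential

theorem deriv_momentFunctional {a : ℕ → A} (ha : ∀ k, (a k)′ = a (k + 1)) (p : A[X]) :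
    (momentFunctional a p)′ =
      momentFunctional a (X * p) + momentFunctional a (mapCoeffs p) := by
  induction p using Polynomial.induction_on' with
  | add p q hp hq =>
    simp only [map_add, mul_add, hp, hq]
    ring
  | monomial k c =>
    rw [mapCoeffs_monomial, X_mul_monomial]
    simp only [momentFunctional_monomial, Derivation.leibniz, smul_eq_mul, ha]
    ring

theorem deriv_det_hankelMatrix_succ {a : ℕ → A} (ha : ∀ k, (a k)′ = a (k + 1)) (m : ℕ) :
    ((hankelMatrix a (m + 1)).det)′ =
      ((hankelMatrix a (m + 1)).updateCol (Fin.last m) fun i => a (m + 1 + i)).det := by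
  rw [Derivation.map_det, Fin.sum_univ_castSucc, Finset.sum_eq_zero, zero_add]
  · congr 2
    ext i
    simp only [hankelMatrix, Matrix.of_apply, ha, Fin.val_last]
    congr 1
    omega
  · intro c _
    refine Matrix.det_zero_of_column_eq (i := c.castSucc) (j := c.succ)
      (Fin.castSucc_lt_succ).ne fun k => ?_
    rw [Matrix.updateCol_self, Matrix.updateCol_ne (Fin.castSucc_lt_succ).ne']
    simp [hankelMatrix, ha, add_assoc]

/-- A nondegenerate Hankel matrix has a monic orthogonal polynomial, whose subleading coefficient
is minus the logarithmic derivative `s` of the Hankel determinant. -/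
theorem exists_orthogonal_polynomial {a : ℕ → A} (ha : ∀ k, (a k)′ = a (k + 1)) {m : ℕ}
    (hu : IsUnit (hankelMatrix a m).det) {s : A}
    (hs : s * (hankelMatrix a m).det = ((hankelMatrix a m).det)′) :
    ∃ P : A[X], P.coeff m = 1 ∧ (∀ i, m < i → P.coeff i = 0) ∧ (X * P).coeff m = -s ∧
      ∀ k < m, momentFunctional a (P * X ^ k) = 0 := by
  obtain ⟨d, hd⟩ := hu.exists_left_inv
  set w : Fin m → A := fun i => a (m + i) with hw
  set v : Fin m → A := d • (hankelMatrix a m).cramer w with hv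
  have hHv : (hankelMatrix a m).mulVec v = w := by
    rw [hv, Matrix.mulVec_smul, Matrix.mulVec_cramer, smul_smul, hd, one_smul]
  set T : A[X] := ∑ i : Fin m, monomial i (v i) with hT
  have hTc : ∀ i : Fin m, T.coeff i = v i := by
    intro i
    simp [hT, coeff_monomial, Fin.val_inj]
  have hTz : ∀ i, m ≤ i → T.coeff i = 0 := by
    intro i hi
    simp only [hT, finsetSum_coeff, coeff_monomial]
    exact Finset.sum_eq_zero fun j _ => if_neg (by omega)
  refine ⟨X ^ m - T, by simp [hTz m le_rfl], fun i hi => ?_, ?_, fun k hk => ?_⟩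
  · simp [coeff_X_pow, hTz i hi.le, hi.ne']
  · cases m with
    | zero =>
      have : s = 0 := by simpa using hs
      simp [this]
    | succ m =>
      rw [coeff_X_mul, coeff_sub, coeff_X_pow, if_neg (by omega), zero_sub, neg_inj]
      have := hTc (Fin.last m)
      rw [Fin.val_last] at this
      rw [this, hv, Pi.smul_apply, Matrix.cramer_apply, ← deriv_det_hankelMatrix_succ ha, ← hs,
        smul_eq_mul, mul_left_comm, hd, mul_one]
  · rw [sub_mul, map_sub, momentFunctional_mul_X_pow a hTz, ← pow_add, ← monomial_one_right_eq_X_pow,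
      momentFunctional_monomial, one_mul, sub_eq_zero]
    have := congrFun hHv ⟨k, hk⟩
    simp only [hw, Matrix.mulVec, dotProduct, hankelMatrix, Matrix.of_apply] at this
    simp only [hTc, this]

theorem airy_moment_recurrence {a : ℕ → A} (ha : ∀ k, (a k)′ = a (k + 1)) {z : A} (hz : z′ = 1)
    (h0 : 2 * a 2 + z * a 0 = 0) (k : ℕ) :
    2 * a (k + 2) + z * a k + k * a (k - 1) = 0 := by
  induction k with
  | zero => simpa using h0
  | succ k ih =>
    have h2 : (2 : A)′ = 0 := Derivation.map_natCast _ 2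
    have := congrArg (fun x : A => x′) ih
    simp only [map_add, Derivation.leibniz, ha, hz, h2, map_zero, smul_eq_mul, mul_zero, add_zero,
      mul_one, Derivation.map_natCast] at this
    rw [Nat.add_sub_cancel, show k + 1 + 2 = k + 2 + 1 by omega]
    rcases k with _ | k
    · push_cast at this ⊢
      linear_combination this
    · rw [Nat.add_sub_cancel] at this
      push_cast at this ⊢
      linear_combination this

/-- The second Painlevé equation for logarithmic derivatives of consecutive Hankel determinants of
an Airy moment sequence, in a commutative differential ring. -/
theorem painleve_two_of_airy_moments {a : ℕ → A} (ha : ∀ k, (a k)′ = a (k + 1)) {z : A}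
    (hz : z′ = 1) (h0 : 2 * a 2 + z * a 0 = 0) {m : ℕ}
    (hu₀ : IsUnit (hankelMatrix a m).det) (hu₁ : IsUnit (hankelMatrix a (m + 1)).det) {s₀ s₁ : A}
    (hs₀ : s₀ * (hankelMatrix a m).det = ((hankelMatrix a m).det)′)
    (hs₁ : s₁ * (hankelMatrix a (m + 1)).det = ((hankelMatrix a (m + 1)).det)′) :
    2 * (s₀ - s₁)′′ = 4 * (s₀ - s₁) ^ 3 + 2 * z * (s₀ - s₁) + 2 * m + 1 := by
  obtain ⟨P, hP1, hPz, hPs, hPo⟩ := exists_orthogonal_polynomial ha hu₀ hs₀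
  obtain ⟨Q, hQ1, hQz, hQs, hQo⟩ := exists_orthogonal_polynomial ha hu₁ hs₁
  rw [coeff_X_mul] at hQs
  have hpear := momentFunctional_pearson (airy_moment_recurrence ha hz h0)
  have hD := deriv_momentFunctional ha
  set L := momentFunctional a with hL
  set h := L (P * X ^ m)
  set k := L (Q * X ^ (m + 1))
  have mulP : ∀ S : A[X], (∀ i, m < i → S.coeff i = 0) → L (P * S) = S.coeff m * h :=
    fun S => momentFunctional_mul_of_orthogonal hPo
  have mulQ : ∀ S : A[X], (∀ i, m + 1 < i → S.coeff i = 0) → L (Q * S) = S.coeff (m + 1) * k :=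
    fun S => momentFunctional_mul_of_orthogonal hQo
  have coeff_XP' : (X * mapCoeffs P).coeff m = -s₀′ := by
    have : X * mapCoeffs P = mapCoeffs (X * P) := by simp [Derivation.leibniz]
    rw [this, coeff_mapCoeffs, hPs, map_neg]
  have coeff_Q' : (mapCoeffs Q).coeff m = -s₁′ := by rw [coeff_mapCoeffs, hQs, map_neg]
  have coeff_P'_zero : ∀ i, m ≤ i → (mapCoeffs P).coeff i = 0 := by
    intro i hi
    rcases hi.eq_or_lt with rfl | hi
    · simp [coeff_mapCoeffs, hP1]
    · simp [coeff_mapCoeffs, hPz i hi]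
  have coeff_Q'_zero : ∀ i, m + 1 ≤ i → (mapCoeffs Q).coeff i = 0 := by
    intro i hi
    rcases hi.eq_or_lt with rfl | hi
    · simp [coeff_mapCoeffs, hQ1]
    · simp [coeff_mapCoeffs, hQz i hi]
  -- the three-term recurrence, with the last term written as a derivative
  set b := s₁ - s₀ with hb
  have recur : X * P = Q + C b * P - mapCoeffs P := by
    rw [← sub_eq_zero]
    refine eq_zero_of_momentFunctional_eq_zero hu₀ (fun i hi => ?_) fun j hj => ?_
    · simp only [coeff_sub, coeff_add, coeff_C_mul, coeff_P'_zero i hi]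
      rcases hi.eq_or_lt with rfl | hi
      · rw [hPs, hQs, hP1, hb]
        ring
      · obtain ⟨i, rfl⟩ := Nat.exists_eq_add_of_lt hi
        rw [coeff_X_mul, hPz (m + i + 1) (by omega)]
        rcases i with _ | i
        · simp [hP1, hQ1]
        · rw [hPz _ (by omega), hQz _ (by omega)]
          ring
    · have h1 := hD (P * X ^ j)
      rw [hPo j hj, map_zero, Derivation.leibniz, Derivation.leibniz_pow] at h1
      simp only [mapCoeffs_X, smul_zero, smul_eq_mul, mul_zero, zero_add] at h1
      have h2 := hQo j (by omega)
      have h3 : L (C b * (P * X ^ j)) = 0 := by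
        rw [hL, momentFunctional_C_mul, ← hL, hPo j hj, mul_zero]
      change L _ = 0
      rw [show (X * P - (Q + C b * P - mapCoeffs P)) * X ^ j =
        X * (P * X ^ j) + X ^ j * mapCoeffs P - Q * X ^ j - C b * (P * X ^ j) by ring,
        map_sub, map_sub, map_add, h3, ← h1, h2]
      ring
  have hC : ∀ (c : A) (p : A[X]), L (C c * p) = c * L p := momentFunctional_C_mul a
  have cancel : ∀ x, x * h = 0 → x = 0 := by
    intro x hx
    have : C x * P = 0 := by
      refine eq_zero_of_momentFunctional_eq_zero hu₁ (fun i hi => ?_) fun j hj => ?_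
      · rw [coeff_C_mul, hPz i (by omega), mul_zero]
      · rw [mul_assoc, momentFunctional_C_mul]
        rcases (Nat.lt_succ_iff.1 hj).eq_or_lt with rfl | hj
        · exact hx
        · rw [hPo j hj, mul_zero]
    simpa [hP1] using congrArg (fun p => coeff p m) this
  have hXz : ∀ (S : A[X]) (d : ℕ), (∀ i, d ≤ i → S.coeff i = 0) →
      ∀ i, d < i → (X * S).coeff i = 0 := by
    intro S d hS i hi
    obtain ⟨i, rfl⟩ := Nat.exists_eq_add_of_lt hi
    rw [coeff_X_mul, hS _ (by omega)]
  have hPP : L (P * P) = h := by rw [mulP P hPz, hP1, one_mul]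
  have hQQ : L (Q * Q) = k := by rw [mulQ Q hQz, hQ1, one_mul]
  have hQP : L (Q * P) = 0 := by
    rw [mulQ P fun i hi => hPz i (by omega), hPz _ (by omega), zero_mul]
  have hPP' : L (P * mapCoeffs P) = 0 := by
    rw [mulP _ fun i hi => coeff_P'_zero i hi.le, coeff_P'_zero m le_rfl, zero_mul]
  have hQP' : L (Q * mapCoeffs P) = 0 := by
    rw [mulQ _ fun i hi => coeff_P'_zero i (by omega), coeff_P'_zero _ (by omega), zero_mul]
  have hQXP' : L (Q * (X * mapCoeffs P)) = 0 := by
    have := hXz _ _ coeff_P'_zero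
    rw [mulQ _ fun i hi => this i (by omega), this _ (by omega), zero_mul]
  have hPXP' : L (P * (X * mapCoeffs P)) = -s₀′ * h := by
    rw [mulP _ (hXz _ _ coeff_P'_zero), coeff_XP']
  have hPQ' : L (P * mapCoeffs Q) = -s₁′ * h := by
    rw [mulP _ fun i hi => coeff_Q'_zero i (by omega), coeff_Q']
  have hQQ' : L (Q * mapCoeffs Q) = 0 := by
    rw [mulQ _ fun i hi => coeff_Q'_zero i (by omega), coeff_Q'_zero _ le_rfl, zero_mul]
  have hQXP : L (Q * (X * P)) = k := by
    rw [recur, show Q * (Q + C b * P - mapCoeffs P) =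
      Q * Q + C b * (Q * P) - Q * mapCoeffs P by ring, map_sub, map_add, hC, hQQ, hQP, hQP']
    ring
  have hPXP : L (P * (X * P)) = b * h := by
    rw [recur, show P * (Q + C b * P - mapCoeffs P) =
      Q * P + C b * (P * P) - P * mapCoeffs P by ring, map_sub, map_add, hC, hPP, hQP, hPP']
    ring
  have hP'P' : L (mapCoeffs P * mapCoeffs P) = s₀′ * h := by
    rw [show mapCoeffs P * mapCoeffs P = Q * mapCoeffs P + C b * (P * mapCoeffs P)
      - P * (X * mapCoeffs P) by linear_combination mapCoeffs P * recur,
      map_sub, map_add, hC, hQP', hPP', hPXP']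
    ring
  have hXPXP : L (X ^ 2 * (P * P)) = k + b ^ 2 * h + s₀′ * h := by
    rw [show X ^ 2 * (P * P) = Q * (X * P) + C b * (P * (X * P)) - Q * mapCoeffs P
      - C b * (P * mapCoeffs P) + mapCoeffs P * mapCoeffs P by
        linear_combination (X * P - mapCoeffs P) * recur, map_add, map_sub, map_sub, map_add,
      hC, hC, hQXP, hPXP, hQP', hPP', hP'P']
    ring
  have hXQXP : L (X ^ 2 * (Q * P)) = L (X * (Q * Q)) + b * k := by
    rw [show X ^ 2 * (Q * P) = X * (Q * Q) + C b * (Q * (X * P)) - Q * (X * mapCoeffs P) by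
        linear_combination X * Q * recur, map_sub, map_add, hC, hQXP, hQXP']
    ring
  have dh : h′ = b * h := by
    have := hD (P * P)
    rw [hPP, Derivation.leibniz, smul_eq_mul, map_add, hPP',
      show X * (P * P) = P * (X * P) by ring, hPXP] at this
    rw [this]
    ring
  have dk : k′ = L (X * (Q * Q)) := by
    have := hD (Q * Q)
    rw [hQQ, Derivation.leibniz, smul_eq_mul, map_add, hQQ'] at this
    rw [this]
    ring
  have k_eq : k = s₁′ * h := by
    have := hD (Q * P)
    rw [hQP, map_zero, Derivation.leibniz, smul_eq_mul, smul_eq_mul, map_add, hQP', hPQ',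
      show X * (Q * P) = Q * (X * P) by ring, hQXP] at this
    linear_combination -this
  have hPdP : L (P * derivative P) = 0 := by
    have hz' : ∀ i, m ≤ i → (derivative P).coeff i = 0 := fun i hi => by
      rw [coeff_derivative, hPz _ (by omega), zero_mul]
    rw [mulP _ fun i hi => hz' i hi.le, hz' m le_rfl, zero_mul]
  have hQdP : L (Q * derivative P) = 0 := by
    have hz' : ∀ i, m ≤ i → (derivative P).coeff i = 0 := fun i hi => by
      rw [coeff_derivative, hPz _ (by omega), zero_mul]
    rw [mulQ _ fun i hi => hz' i (by omega), hz' _ (by omega), zero_mul]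
  have hPdQ : L (P * derivative Q) = (m + 1) * h := by
    rw [mulP _ fun i hi => by rw [coeff_derivative, hQz _ (by omega), zero_mul],
      coeff_derivative, hQ1, one_mul]
  have string₁ : z + 2 * (s₁′ + b ^ 2 + s₀′) = 0 := by
    apply cancel
    have := hpear (P * P)
    rw [derivative_mul, map_add, mul_comm (derivative P), hPdP, hPP, hXPXP, k_eq] at this
    linear_combination this
  have string₂ : (m + 1 : A) + 2 * s₁′′ + 4 * b * s₁′ = 0 := by
    apply cancel
    have := hpear (Q * P)
    rw [derivative_mul, map_add, mul_comm (derivative Q), hPdQ, hQdP, hQP, hXQXP, ← dk, k_eq,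
      Derivation.leibniz, smul_eq_mul, smul_eq_mul, dh] at this
    linear_combination this
  have h2 : (2 : A)′ = 0 := Derivation.map_natCast _ 2
  have dstring₁ := congrArg (fun x : A => x′) string₁
  simp only [hb, map_add, map_sub, pow_two, Derivation.leibniz, hz, h2, map_zero,
    smul_eq_mul] at dstring₁ string₁ string₂ ⊢
  linear_combination dstring₁ - 2 * string₂ + 2 * (s₁ - s₀) * string₁

end Moments

section HolomorphicRing

open TopologicalSpace Differential

/-- The ring of holomorphic functions on an open subset of the complex plane. -/
def holomorphicSubring (U : Opens ℂ) : Subring (U → ℂ) where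
  carrier := {f | ∃ F : ℂ → ℂ, DifferentiableOn ℂ F U ∧ ∀ z : U, f z = F z}
  mul_mem' := by
    rintro f g ⟨F, hF, hf⟩ ⟨G, hG, hg⟩
    exact ⟨F * G, hF.mul hG, fun z => by simp [hf, hg]⟩
  one_mem' := ⟨1, differentiableOn_const 1, fun _ => rfl⟩
  add_mem' := by
    rintro f g ⟨F, hF, hf⟩ ⟨G, hG, hg⟩
    exact ⟨F + G, hF.add hG, fun z => by simp [hf, hg]⟩
  zero_mem' := ⟨0, differentiableOn_const 0, fun _ => rfl⟩
  neg_mem' := by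
    rintro f ⟨F, hF, hf⟩
    exact ⟨-F, hF.neg, fun z => by simp [hf]⟩

namespace holomorphicSubring

variable {U : Opens ℂ}

/-- The restriction to `U` of a function holomorphic on `U`. -/
def mk (F : ℂ → ℂ) (hF : DifferentiableOn ℂ F U) : holomorphicSubring U :=
  ⟨fun z => F z, F, hF, fun _ => rfl⟩

theorem exists_eq_mk (f : holomorphicSubring U) : ∃ F hF, f = mk F hF := by
  obtain ⟨f, F, hF, hf⟩ := f
  exact ⟨F, hF, Subtype.ext (funext hf)⟩

theorem mk_eq_mk {F G : ℂ → ℂ} (hF : DifferentiableOn ℂ F U) (hG : DifferentiableOn ℂ G U) :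
    mk F hF = mk G hG ↔ Set.EqOn F G U :=
  ⟨fun h z hz => congrFun (congrArg Subtype.val h) ⟨z, hz⟩,
    fun h => Subtype.ext (funext fun z => h z.2)⟩

/-- The derivative of a holomorphic function. -/
noncomputable def derivFun (f : holomorphicSubring U) : holomorphicSubring U :=
  mk (deriv f.2.choose) (f.2.choose_spec.1.deriv U.isOpen)

theorem derivFun_mk (F : ℂ → ℂ) (hF : DifferentiableOn ℂ F U) :
    derivFun (mk F hF) = mk (deriv F) (hF.deriv U.isOpen) := by
  rw [derivFun, mk_eq_mk]
  exact Set.EqOn.deriv (fun z hz => ((mk F hF).2.choose_spec.2 ⟨z, hz⟩).symm) U.isOpen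

noncomputable instance : Differential (holomorphicSubring U) where
  deriv := Derivation.mk'
    (AddMonoidHom.mk' derivFun (by
      intro f g
      obtain ⟨F, hF, rfl⟩ := exists_eq_mk f
      obtain ⟨G, hG, rfl⟩ := exists_eq_mk g
      change derivFun (mk (F + G) (hF.add hG)) = _
      simp only [derivFun_mk]
      refine Subtype.ext (funext fun z => ?_)
      exact deriv_add (hF.differentiableAt (U.isOpen.mem_nhds z.2))
        (hG.differentiableAt (U.isOpen.mem_nhds z.2)))).toIntLinearMap (by
      intro f g
      obtain ⟨F, hF, rfl⟩ := exists_eq_mk f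
      obtain ⟨G, hG, rfl⟩ := exists_eq_mk g
      change derivFun (mk (F * G) (hF.mul hG)) = _ • derivFun _ + _ • derivFun _
      simp only [derivFun_mk]
      refine Subtype.ext (funext fun z => ?_)
      refine (deriv_mul (hF.differentiableAt (U.isOpen.mem_nhds z.2))
        (hG.differentiableAt (U.isOpen.mem_nhds z.2))).trans ?_
      change _ = F z * deriv G z + G z * deriv F z
      ring)

theorem deriv_mk (F : ℂ → ℂ) (hF : DifferentiableOn ℂ F U) :
    (mk F hF)′ = mk (deriv F) (hF.deriv U.isOpen) :=
  derivFun_mk F hF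

theorem isUnit_mk {F : ℂ → ℂ} (hF : DifferentiableOn ℂ F U) (h : ∀ z ∈ U, F z ≠ 0) :
    IsUnit (mk F hF) :=
  IsUnit.of_mul_eq_one (mk F⁻¹ (hF.inv h))
    (Subtype.ext (funext fun z => mul_inv_cancel₀ (h z z.2)))

end holomorphicSubring

end HolomorphicRing

open scoped Differential

/-- Airy-type solutions of P_II: if `φ` solves `φ'' + zφ/2 = 0` on an open set `U`, and
`τ_m` is the `m × m` Hankel determinant of derivatives of `φ` (with `τ_0 = 1`), and
`τ_{n−1}, τ_n` are nonvanishing on `U`, then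
`q_n = (log (τ_{n−1}/τ_n))' = τ_{n−1}'/τ_{n−1} − τ_n'/τ_n` solves P_II(n − 1/2) on `U`. -/
theorem airy_determinant_solutions_PII (n : ℕ) (hn : 1 ≤ n) (U : Set ℂ) (hU : IsOpen U)
    (φ : ℂ → ℂ)
    (hφ : ContDiffOn ℂ ⊤ φ U)
    (hairy : ∀ z ∈ U, deriv (deriv φ) z + z / 2 * φ z = 0)
    (τ : ℕ → ℂ → ℂ)
    (hτ0 : ∀ z, τ 0 z = 1)
    (hτ : ∀ m : ℕ, 1 ≤ m → ∀ z,
      τ m z = Matrix.det (Matrix.of fun j k : Fin m => iteratedDeriv ((j : ℕ) + (k : ℕ)) φ z))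
    (hτn0 : ∀ z ∈ U, τ n z ≠ 0)
    (hτn10 : ∀ z ∈ U, τ (n - 1) z ≠ 0)
    (q : ℂ → ℂ)
    (hqdef : ∀ z, q z = deriv (τ (n - 1)) z / τ (n - 1) z - deriv (τ n) z / τ n z) :
    ∀ z ∈ U, DifferentiableAt ℂ q z ∧ DifferentiableAt ℂ (deriv q) z ∧
      deriv (deriv q) z = 2 * q z ^ 3 + z * q z + ((n : ℂ) - 1 / 2) := by
  obtain ⟨m, rfl⟩ : ∃ m, n = m + 1 := ⟨n - 1, by omega⟩
  rw [Nat.add_sub_cancel] at hτn10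
  simp only [Nat.add_sub_cancel] at hqdef
  let V : TopologicalSpace.Opens ℂ := ⟨U, hU⟩
  have hτdet : ∀ k z, τ k z =
      Matrix.det (Matrix.of fun i j : Fin k => iteratedDeriv ((i : ℕ) + (j : ℕ)) φ z) := by
    rintro (_ | k) z
    · rw [hτ0, Matrix.det_fin_zero]
    · exact hτ _ (by omega) z
  have hdiff : ∀ k, DifferentiableOn ℂ (iteratedDeriv k φ) V := by
    intro k
    induction k with
    | zero =>
      rw [iteratedDeriv_zero]
      exact hφ.differentiableOn (by simp)
    | succ k ih =>
      rw [iteratedDeriv_succ]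
      exact ih.deriv hU
  let a : ℕ → holomorphicSubring V := fun k => holomorphicSubring.mk (iteratedDeriv k φ) (hdiff k)
  have ha : ∀ k, (a k)′ = a (k + 1) := fun k => by
    simp only [a, holomorphicSubring.deriv_mk, iteratedDeriv_succ]
  have hdet : ∀ k, ((hankelMatrix a k).det : V → ℂ) = fun z : V => τ k z := by
    intro k
    funext z
    rw [hτdet]
    exact RingHom.map_det ((Pi.evalRingHom (fun _ : V => ℂ) z).comp
      (holomorphicSubring V).subtype) (hankelMatrix a k)
  have hτd : ∀ k, DifferentiableOn ℂ (τ k) V := by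
    intro k
    obtain ⟨F, hF, h⟩ := (hankelMatrix a k).det.2
    exact hF.congr fun z hz => (congrFun (hdet k) ⟨z, hz⟩).symm.trans (h ⟨z, hz⟩)
  have hdet' : ∀ k, (hankelMatrix a k).det = holomorphicSubring.mk (τ k) (hτd k) :=
    fun k => Subtype.ext (hdet k)
  have hsd : ∀ k, (∀ z ∈ U, τ k z ≠ 0) → DifferentiableOn ℂ (fun z => deriv (τ k) z / τ k z) V :=
    fun k hk => ((hτd k).deriv hU).div (hτd k) hk
  have hs : ∀ k (hk : ∀ z ∈ U, τ k z ≠ 0),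
      holomorphicSubring.mk _ (hsd k hk) * (hankelMatrix a k).det = ((hankelMatrix a k).det)′ := by
    intro k hk
    rw [hdet', holomorphicSubring.deriv_mk]
    exact Subtype.ext (funext fun z => div_mul_cancel₀ _ (hk z z.2))
  have hu : ∀ k, (∀ z ∈ U, τ k z ≠ 0) → IsUnit (hankelMatrix a k).det := fun k hk =>
    hdet' k ▸ holomorphicSubring.isUnit_mk (hτd k) hk
  have hqd : DifferentiableOn ℂ q V :=
    ((hsd m hτn10).sub (hsd (m + 1) hτn0)).congr fun z _ => hqdef z
  have hz : (holomorphicSubring.mk (U := V) id differentiableOn_id)′ = 1 := by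
    rw [holomorphicSubring.deriv_mk]
    exact Subtype.ext (funext fun z => deriv_id _)
  have hairy' : 2 * a 2 + holomorphicSubring.mk (U := V) id differentiableOn_id * a 0 = 0 := by
    refine Subtype.ext (funext fun z => ?_)
    change 2 * iteratedDeriv 2 φ z + z * iteratedDeriv 0 φ z = 0
    rw [iteratedDeriv_succ, iteratedDeriv_one, iteratedDeriv_zero]
    linear_combination 2 * hairy z z.2
  have main := painleve_two_of_airy_moments ha hz hairy' (hu m hτn10) (hu (m + 1) hτn0)
    (hs m hτn10) (hs (m + 1) hτn0)
  have hq : holomorphicSubring.mk _ (hsd m hτn10) - holomorphicSubring.mk _ (hsd (m + 1) hτn0) =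
      holomorphicSubring.mk q hqd := Subtype.ext (funext fun z => (hqdef z).symm)
  rw [hq, holomorphicSubring.deriv_mk, holomorphicSubring.deriv_mk] at main
  intro z hzU
  refine ⟨hqd.differentiableAt (hU.mem_nhds hzU),
    (hqd.deriv hU).differentiableAt (hU.mem_nhds hzU), ?_⟩
  have hmain : 2 * deriv (deriv q) z = 4 * q z ^ 3 + 2 * z * q z + 2 * m + 1 :=
    congrFun (congrArg Subtype.val main) ⟨z, hzU⟩
  push_cast
  linear_combination hmain / 2
end

section
/- Let n ≥ 1 and let U ⊆ ℂ be open. Suppose φ : ℂ → ℂ is infinitely differentiable on U and satisfies φ''(z) + (z/2) φ(z) = 0 for all z ∈ U. For m ≥ 1 let τ_m(z) = det[φ^{(j+k)}(z)]_{j,k=0}^{m−1} (the m×m determinant whose (j,k) entry is the (j+k)-th derivative of φ), and set τ_0(z) = 1. Suppose τ_n(z) ≠ 0 on U and that p_n(z) = −2 (d²/dz²) log τ_n(z) = −2 (τ_n''(z) τ_n(z) − (τ_n'(z))²)/τ_n(z)² is nonzero on U. Then p_n satisfies the Painlevé XXXIV equation P_34(n − 1/2): p_n''(z) = (p_n'(z))²/(2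 p_n(z)) + 2 p_n(z)² − z p_n(z) − n²/(2 p_n(z)) for all z ∈ U. -/
open Matrix

/-- The index sequence `(0, …, k - 1, a)`. -/
abbrev borderIndex (k a : ℕ) : Fin k ⊕ Unit → ℕ :=
  Sum.elim (fun i => (i : ℕ)) fun _ => a

/-- The determinant of the matrix `u (rᵢ + cⱼ)`, where `r = (0, …, k - 1, a)` and
`c = (0, …, k - 1, b)`. -/
def borderedHankel (u : ℕ → ℂ) (k a b : ℕ) : ℂ :=
  det (of fun i j : Fin k ⊕ Unit => u (borderIndex k a i + borderIndex k b j))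

lemma borderedHankel_comm (u : ℕ → ℂ) (k a b : ℕ) :
    borderedHankel u k a b = borderedHankel u k b a := by
  unfold borderedHankel
  rw [← det_transpose]
  congr 1
  ext i j
  simp [add_comm]

lemma borderedHankel_self (u : ℕ → ℂ) (k : ℕ) :
    borderedHankel u k k k = det (of fun i j : Fin (k + 1) => u (i + j)) := by
  rw [← det_submatrix_equiv_self
    ((Equiv.sumCongr (Equiv.refl (Fin k)) (Equiv.ofUnique Unit (Fin 1))).trans finSumFinEquiv)]
  unfold borderedHankel
  congr 1
  ext (i | i) (j | j) <;> simp

/-- A special case of the Desnanot–Jacobi identity for Hankel determinants. -/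
lemma hankel_desnanot_jacobi (u : ℕ → ℂ) (k : ℕ)
    (h : det (of fun i j : Fin k => u (i + j)) ≠ 0) :
    det (of fun i j : Fin (k + 2) => u (i + j)) * det (of fun i j : Fin k => u (i + j)) =
      borderedHankel u k (k + 1) (k + 1) * borderedHankel u k k k
        - borderedHankel u k (k + 1) k ^ 2 := by
  set A : Matrix (Fin k) (Fin k) ℂ := of fun i j : Fin k => u (i + j) with hA
  have : Invertible A := invertibleOfIsUnitDet A (isUnit_iff_ne_zero.mpr h)
  let s : ℕ → ℕ → ℂ := fun a b =>
    u (a + b) - ((fun j : Fin k => u (a + j)) ᵥ* ⅟A) ⬝ᵥ (fun i : Fin k => u (i + b))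
  have hbord : ∀ a b, borderedHankel u k a b = det A * s a b := by
    intro a b
    have : (of fun i j : Fin k ⊕ Unit => u (borderIndex k a i + borderIndex k b j)) =
        fromBlocks A (of fun i _ => u (i + b)) (of fun _ j => u (a + j))
          (of fun _ _ => u (a + b)) := by
      ext (i | i) (j | j) <;> simp [hA]
    unfold borderedHankel
    rw [this, det_fromBlocks₁₁, det_unique (n := Unit)]
    rfl
  have hfull : det (of fun i j : Fin (k + 2) => u (i + j)) =
      det A * (s k k * s (k + 1) (k + 1) - s k (k + 1) * s (k + 1) k) := by
    rw [← det_submatrix_equiv_self (finSumFinEquiv (m := k) (n := 2))]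
    have : (of fun i j : Fin (k + 2) => u (i + j)).submatrix finSumFinEquiv finSumFinEquiv =
        fromBlocks A (of fun i (b : Fin 2) => u (i + (k + b)))
          (of fun (a : Fin 2) j => u ((k + a) + j))
          (of fun (a b : Fin 2) => u ((k + a) + (k + b))) := by
      ext (i | i) (j | j) <;> simp [hA]
    rw [this, det_fromBlocks₁₁, det_fin_two]
    rfl
  have hsymm : s k (k + 1) = s (k + 1) k := by
    have := borderedHankel_comm u k k (k + 1)
    rw [hbord, hbord] at this
    exact mul_left_cancel₀ h this
  rw [hfull, hbord, hbord, hbord, hsymm]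
  ring

/-- The derivative of a determinant is the sum over the rows of the determinants in which this row
has been differentiated. -/
lemma hasDerivAt_det {ι : Type*} [Fintype ι] [DecidableEq ι] {M : ℂ → Matrix ι ι ℂ}
    {M' : Matrix ι ι ℂ} {z : ℂ} (h : ∀ i j, HasDerivAt (fun w => M w i j) (M' i j) z) :
    HasDerivAt (fun w => det (M w)) (∑ i, det ((M z).updateRow i (M' i))) z := by
  have hM : HasDerivAt (F := ι → ι → ℂ) (fun w => M w) (fun i => M' i) z :=
    hasDerivAt_pi.mpr fun i => hasDerivAt_pi.mpr fun j => h i j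
  let D : ContinuousMultilinearMap ℂ (fun _ : ι => ι → ℂ) ℂ :=
    { (detRowAlternating : (ι → ℂ) [⋀^ι]→ₗ[ℂ] ℂ).toMultilinearMap with
      cont := Continuous.matrix_det continuous_id }
  have := (D.hasFDerivAt (x := M z)).comp_hasDerivAt z hM
  exact this.congr_deriv (D.linearDeriv_apply (M z) fun i => M' i)

lemma hasDerivAt_borderedHankel {u : ℂ → ℕ → ℂ} {z : ℂ}
    (hu : ∀ m, HasDerivAt (fun w => u w m) (u z (m + 1)) z) (k b : ℕ) :
    HasDerivAt (fun w => borderedHankel (u w) k k b) (borderedHankel (u z) k (k + 1) b) z := by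
  have := hasDerivAt_det (z := z)
    (M := fun w => of fun i j : Fin k ⊕ Unit => u w (borderIndex k k i
        + borderIndex k b j))
    (M' := of fun i j : Fin k ⊕ Unit => u z (borderIndex k k i
        + borderIndex k b j + 1))
    (fun i j => hu _)
  unfold borderedHankel
  convert! this using 1
  rw [Fintype.sum_sum_type, Finset.sum_eq_zero, zero_add, Fintype.sum_unique]
  · congr 1
    ext (i | i) j
    · simp [updateRow_apply]
    · simp [updateRow_apply, add_right_comm]
  · intro i _
    by_cases hi : (i : ℕ) + 1 < k
    · refine det_zero_of_row_eq (i := Sum.inl i) (j := Sum.inl ⟨i + 1, hi⟩) ?_ ?_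
      · simp [Fin.ext_iff]
      · ext j
        simp [updateRow_apply, Fin.ext_iff, add_right_comm]
    · refine det_zero_of_row_eq (i := Sum.inl i) (j := Sum.inr ()) (by simp) ?_
      ext j
      have : k = i + 1 := by omega
      simp only [updateRow_apply, of_apply]
      simp [add_right_comm, ← this]

/-- Minus twice the second derivative of the logarithm of `f`. -/
noncomputable def airyPotential (f : ℂ → ℂ) (z : ℂ) : ℂ := -2 * deriv (logDeriv f) z

section

variable {V : Set ℂ} {a b c : ℂ → ℂ}

lemma differentiableOn_logDeriv (hV : IsOpen V) (hb : DifferentiableOn ℂ b V)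
    (hb0 : ∀ z ∈ V, b z ≠ 0) : DifferentiableOn ℂ (logDeriv b) V :=
  (hb.deriv hV).div hb hb0

lemma differentiableOn_airyPotential (hV : IsOpen V) (hb : DifferentiableOn ℂ b V)
    (hb0 : ∀ z ∈ V, b z ≠ 0) : DifferentiableOn ℂ (airyPotential b) V :=
  ((differentiableOn_logDeriv hV hb hb0).deriv hV).const_mul _

lemma airyPotential_eq (hV : IsOpen V) (hb : DifferentiableOn ℂ b V) {z : ℂ} (hz : z ∈ V)
    (hb0 : b z ≠ 0) :
    airyPotential b z = -2 * (deriv (deriv b) z * b z - deriv b z ^ 2) / b z ^ 2 := by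
  have hn := hV.mem_nhds hz
  have := ((hb.deriv hV).differentiableAt hn).hasDerivAt.div
    (hb.differentiableAt hn).hasDerivAt hb0
  rw [airyPotential, show logDeriv b = deriv b / b from rfl, this.deriv]
  ring

lemma hasDerivAt_logDeriv_sub (hV : IsOpen V) (ha : DifferentiableOn ℂ a V)
    (hb : DifferentiableOn ℂ b V) (ha0 : ∀ z ∈ V, a z ≠ 0) (hb0 : ∀ z ∈ V, b z ≠ 0)
    {z : ℂ} (hz : z ∈ V) :
    HasDerivAt (fun w => logDeriv b w - logDeriv a w)
      ((airyPotential a z - airyPotential b z) / 2) z := by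
  have hn := hV.mem_nhds hz
  refine (((differentiableOn_logDeriv hV hb hb0).differentiableAt hn).hasDerivAt.fun_sub
    ((differentiableOn_logDeriv hV ha ha0).differentiableAt hn).hasDerivAt).congr_deriv ?_
  simp only [airyPotential]
  ring

/-- The relations, on `V`, between the consecutive determinants `a = τ_k` and `b = τ_{k+1}`. -/
structure AiryPair (V : Set ℂ) (k : ℕ) (a b : ℂ → ℂ) : Prop where
  isOpen : IsOpen V
  left : DifferentiableOn ℂ a V
  right : DifferentiableOn ℂ b V
  left_ne : ∀ z ∈ V, a z ≠ 0
  right_ne : ∀ z ∈ V, b z ≠ 0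
  deriv_left : ∀ z ∈ V, deriv (airyPotential a) z =
    2 * (logDeriv b z - logDeriv a z) * airyPotential a z - k
  add_eq : ∀ z ∈ V, airyPotential a z + airyPotential b z =
    2 * (logDeriv b z - logDeriv a z) ^ 2 + z

namespace AiryPair

variable {k : ℕ}

lemma mono (h : AiryPair V k a b) {W : Set ℂ} (hW : IsOpen W) (hWV : W ⊆ V) :
    AiryPair W k a b where
  isOpen := hW
  left := h.left.mono hWV
  right := h.right.mono hWV
  left_ne z hz := h.left_ne z (hWV hz)
  right_ne z hz := h.right_ne z (hWV hz)
  deriv_left z hz := h.deriv_left z (hWV hz)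
  add_eq z hz := h.add_eq z (hWV hz)

lemma hasDerivAt_sub (h : AiryPair V k a b) {z : ℂ} (hz : z ∈ V) :
    HasDerivAt (fun w => logDeriv b w - logDeriv a w)
      ((airyPotential a z - airyPotential b z) / 2) z :=
  hasDerivAt_logDeriv_sub h.isOpen h.left h.right h.left_ne h.right_ne hz

lemma hasDerivAt_right (h : AiryPair V k a b) {z : ℂ} (hz : z ∈ V) :
    HasDerivAt (airyPotential b)
      (-2 * (logDeriv b z - logDeriv a z) * airyPotential b z + (k + 1)) z := by
  have hn := h.isOpen.mem_nhds hz
  have hP := ((differentiableOn_airyPotential h.isOpen h.left h.left_ne).differentiableAt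
    hn).hasDerivAt
  have hd := ((((h.hasDerivAt_sub hz).fun_pow 2).const_mul 2).add (hasDerivAt_id z)).sub hP
  refine (hd.congr_of_eventuallyEq ?_).congr_deriv ?_
  · filter_upwards [hn] with w hw
    have := h.add_eq w hw
    simp only [Pi.add_apply, Pi.sub_apply, id]
    linear_combination this
  · rw [h.deriv_left z hz]
    push_cast
    ring

lemma exists_airyPotential_ne_zero (h : AiryPair V k a b) (hne : V.Nonempty) :
    ∃ z ∈ V, airyPotential b z ≠ 0 := by
  by_contra! h0
  obtain ⟨z, hz⟩ := hne
  have hzero : HasDerivAt (airyPotential b) 0 z :=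
    (hasDerivAt_const z (0 : ℂ)).congr_of_eventuallyEq
      (by filter_upwards [h.isOpen.mem_nhds hz] with w hw using h0 w hw)
  have := hzero.unique (h.hasDerivAt_right hz)
  rw [h0 z hz, mul_zero, zero_add] at this
  exact Nat.cast_add_one_ne_zero k this.symm

/-- The Bäcklund transformation along the Toda chain. -/
lemma succ (h : AiryPair V k a b) (hc : DifferentiableOn ℂ c V) (hc0 : ∀ z ∈ V, c z ≠ 0)
    (htoda : ∀ z ∈ V, c z * a z = deriv (deriv b) z * b z - deriv b z ^ 2) :
    AiryPair V (k + 1) b c := by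
  have hP : ∀ z ∈ V, airyPotential b z = -2 * (c z * a z) / b z ^ 2 := fun z hz => by
    rw [htoda z hz, airyPotential_eq h.isOpen h.right hz (h.right_ne z hz)]
  have hP0 : ∀ z ∈ V, airyPotential b z ≠ 0 := fun z hz => by
    rw [hP z hz]
    exact div_ne_zero (mul_ne_zero (by norm_num) (mul_ne_zero (hc0 z hz) (h.left_ne z hz)))
      (pow_ne_zero 2 (h.right_ne z hz))
  have hdP : ∀ z ∈ V, deriv (airyPotential b) z = airyPotential b z *
      ((logDeriv c z - logDeriv b z) - (logDeriv b z - logDeriv a z)) := fun z hz => by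
    have hn := h.isOpen.mem_nhds hz
    have hd := (((hc.differentiableAt hn).hasDerivAt.mul
      (h.left.differentiableAt hn).hasDerivAt).const_mul (-2)).div
      ((h.right.differentiableAt hn).hasDerivAt.fun_pow 2) (pow_ne_zero 2 (h.right_ne z hz))
    have he : airyPotential b =ᶠ[nhds z] fun w => -2 * (c w * a w) / b w ^ 2 := by
      filter_upwards [hn] with w hw using hP w hw
    rw [he.deriv_eq]
    refine hd.deriv.trans ?_
    rw [hP z hz]
    simp only [logDeriv_apply, Pi.mul_apply]
    have := hc0 z hz
    have := h.left_ne z hz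
    have := h.right_ne z hz
    field_simp
    push_cast
    ring
  have hsum : ∀ z ∈ V, airyPotential b z *
      ((logDeriv c z - logDeriv b z) + (logDeriv b z - logDeriv a z)) = k + 1 := fun z hz => by
    have h1 := (h.hasDerivAt_right hz).deriv
    rw [hdP z hz] at h1
    linear_combination h1
  refine ⟨h.isOpen, h.right, hc, h.right_ne, hc0, fun z hz => ?_, fun z hz => ?_⟩
  · rw [hdP z hz]
    push_cast
    linear_combination -hsum z hz
  · have hn := h.isOpen.mem_nhds hz
    have hv := hasDerivAt_logDeriv_sub h.isOpen h.right hc h.right_ne hc0 hz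
    have hs := (((differentiableOn_airyPotential h.isOpen h.right h.right_ne).differentiableAt
      hn).hasDerivAt).mul (hv.add (h.hasDerivAt_sub hz))
    have hconst := (hasDerivAt_const z ((k : ℂ) + 1)).congr_of_eventuallyEq
      (f₁ := airyPotential b * ((fun w => logDeriv c w - logDeriv b w) +
        fun w => logDeriv b w - logDeriv a w))
      (by filter_upwards [hn] with w hw using hsum w hw)
    have h0 := hs.unique hconst
    rw [hdP z hz] at h0
    simp only [Pi.add_apply] at h0
    have hadd := h.add_eq z hz
    refine mul_left_cancel₀ (hP0 z hz) ?_
    linear_combination (-2) * h0 + airyPotential b z * hadd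

/-- The Painlevé XXXIV equation for `airyPotential b`, cleared of denominators. -/
lemma painleve (h : AiryPair V k a b) {z : ℂ} (hz : z ∈ V) :
    2 * airyPotential b z * deriv (deriv (airyPotential b)) z =
      deriv (airyPotential b) z ^ 2 + 4 * airyPotential b z ^ 3 - 2 * z * airyPotential b z ^ 2
        - (k + 1) ^ 2 := by
  have hn := h.isOpen.mem_nhds hz
  have he : deriv (airyPotential b) =ᶠ[nhds z]
      fun w => -2 * (logDeriv b w - logDeriv a w) * airyPotential b w + ((k : ℂ) + 1) := by
    filter_upwards [hn] with w hw using (h.hasDerivAt_right hw).deriv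
  have hd := (((h.hasDerivAt_sub hz).const_mul (-2)).mul (h.hasDerivAt_right hz)).add_const
    ((k : ℂ) + 1)
  have hdd : deriv (deriv (airyPotential b)) z = _ := he.deriv_eq.trans hd.deriv
  rw [hdd, (h.hasDerivAt_right hz).deriv]
  have hadd := h.add_eq z hz
  linear_combination (-2) * airyPotential b z ^ 2 * hadd

end AiryPair

end

section

variable {U : Set ℂ} {φ : ℂ → ℂ} {τ : ℕ → ℂ → ℂ}

lemma hasDerivAt_iteratedDeriv (hU : IsOpen U) (hφ : DifferentiableOn ℂ φ U) (m : ℕ) :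
    ∀ z ∈ U, HasDerivAt (iteratedDeriv m φ) (iteratedDeriv (m + 1) φ z) z := by
  have hd : ∀ m, DifferentiableOn ℂ (iteratedDeriv m φ) U := fun m => by
    induction m with
    | zero => rwa [iteratedDeriv_zero]
    | succ m ih =>
      rw [iteratedDeriv_succ]
      exact ih.deriv hU
  intro z hz
  rw [iteratedDeriv_succ]
  exact ((hd m).differentiableAt (hU.mem_nhds hz)).hasDerivAt

lemma hankel_eq (hτ0 : ∀ z, τ 0 z = 1)
    (hτ : ∀ m : ℕ, 1 ≤ m → ∀ z,
      τ m z = det (of fun j k : Fin m => iteratedDeriv ((j : ℕ) + (k : ℕ)) φ z))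
    (m : ℕ) (z : ℂ) :
    τ m z = det (of fun j k : Fin m => iteratedDeriv ((j : ℕ) + (k : ℕ)) φ z) := by
  rcases m.eq_zero_or_pos with rfl | hm
  · rw [hτ0, det_fin_zero]
  · exact hτ m hm z

lemma differentiableOn_hankel (hU : IsOpen U) (hφ : DifferentiableOn ℂ φ U)
    (hτ : ∀ m z, τ m z = det (of fun j k : Fin m => iteratedDeriv ((j : ℕ) + (k : ℕ)) φ z))
    (m : ℕ) : DifferentiableOn ℂ (τ m) U := fun z hz => by
  rw [funext (hτ m)]
  exact (hasDerivAt_det (M := fun w => of fun j k : Fin m =>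
    iteratedDeriv ((j : ℕ) + (k : ℕ)) φ w)
    (M' := of fun j k : Fin m => iteratedDeriv ((j : ℕ) + (k : ℕ) + 1) φ z) fun j k =>
      hasDerivAt_iteratedDeriv hU hφ _ z hz).differentiableAt.differentiableWithinAt

/-- The Toda equation for Hankel determinants. -/
lemma hankel_toda (hU : IsOpen U) (hφ : DifferentiableOn ℂ φ U)
    (hτ : ∀ m z, τ m z = det (of fun j k : Fin m => iteratedDeriv ((j : ℕ) + (k : ℕ)) φ z))
    (k : ℕ) {z : ℂ} (hz : z ∈ U) (h0 : τ k z ≠ 0) :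
    τ (k + 2) z * τ k z =
      deriv (deriv (τ (k + 1))) z * τ (k + 1) z - deriv (τ (k + 1)) z ^ 2 := by
  let u : ℂ → ℕ → ℂ := fun w m => iteratedDeriv m φ w
  have hu : ∀ w ∈ U, ∀ m, HasDerivAt (fun w => u w m) (u w (m + 1)) w := fun w hw m =>
    hasDerivAt_iteratedDeriv hU hφ m w hw
  have ht : τ (k + 1) = fun w => borderedHankel (u w) k k k := by
    ext w
    rw [borderedHankel_self, hτ]
  have ht' : ∀ w ∈ U, deriv (τ (k + 1)) w = borderedHankel (u w) k (k + 1) k := fun w hw => by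
    rw [ht]
    exact (hasDerivAt_borderedHankel (hu w hw) k k).deriv
  have ht'' : deriv (deriv (τ (k + 1))) z = borderedHankel (u z) k (k + 1) (k + 1) := by
    have he : deriv (τ (k + 1)) =ᶠ[nhds z] fun w => borderedHankel (u w) k k (k + 1) := by
      filter_upwards [hU.mem_nhds hz] with w hw
      rw [ht' w hw, borderedHankel_comm]
    rw [he.deriv_eq]
    exact (hasDerivAt_borderedHankel (hu z hz) k (k + 1)).deriv
  rw [hτ] at h0
  rw [ht'', ht' z hz, ht, hτ, hτ]
  exact hankel_desnanot_jacobi (u z) k h0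

lemma airyPair_zero (hU : IsOpen U) (hφ : DifferentiableOn ℂ φ U)
    (hairy : ∀ z ∈ U, deriv (deriv φ) z + z / 2 * φ z = 0) (hφ0 : ∀ z ∈ U, φ z ≠ 0) :
    AiryPair U 0 (fun _ => 1) φ := by
  have hl : logDeriv (fun _ : ℂ => (1 : ℂ)) = 0 := logDeriv_const 1
  have hP : airyPotential (fun _ => 1) = 0 := by
    ext z
    simp [airyPotential, hl]
  refine ⟨hU, differentiableOn_const 1, hφ, fun _ _ => one_ne_zero, hφ0, fun z hz => ?_,
    fun z hz => ?_⟩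
  · simp [hP]
  · rw [airyPotential_eq hU hφ hz (hφ0 z hz), hP, hl]
    have := hφ0 z hz
    simp only [Pi.zero_apply, logDeriv_apply]
    field_simp
    linear_combination (-2) * φ z * hairy z hz

lemma exists_airyPair (hU : IsOpen U) (hφ : DifferentiableOn ℂ φ U)
    (hairy : ∀ z ∈ U, deriv (deriv φ) z + z / 2 * φ z = 0)
    (hτ : ∀ m z, τ m z = det (of fun j k : Fin m => iteratedDeriv ((j : ℕ) + (k : ℕ)) φ z))
    {W : Set ℂ} (hW : IsOpen W) (hWU : W ⊆ U) {z₀ : ℂ} (hz₀ : z₀ ∈ W) (hφ₀ : φ z₀ ≠ 0) (k : ℕ) :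
    ∃ V ⊆ W, V.Nonempty ∧ AiryPair V k (τ k) (τ (k + 1)) := by
  induction k with
  | zero =>
    have hτ0 : τ 0 = fun _ => 1 := by
      ext z
      rw [hτ, det_fin_zero]
    have hτ1 : τ (0 + 1) = φ := by
      ext z
      simp [hτ]
    have hV : IsOpen (W ∩ φ ⁻¹' {0}ᶜ) :=
      (hφ.mono hWU).continuousOn.isOpen_inter_preimage hW isOpen_compl_singleton
    refine ⟨W ∩ φ ⁻¹' {0}ᶜ, Set.inter_subset_left, ⟨z₀, hz₀, hφ₀⟩, ?_⟩
    rw [hτ0, hτ1]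
    exact airyPair_zero hV (hφ.mono fun z hz => hWU hz.1) (fun z hz => hairy z (hWU hz.1))
      fun z hz => hz.2
  | succ k ih =>
    obtain ⟨V, hVW, hne, h⟩ := ih
    obtain ⟨z, hz, hPz⟩ := h.exists_airyPotential_ne_zero hne
    have hVU : V ⊆ U := hVW.trans hWU
    have htoda := fun w (hw : w ∈ V) => hankel_toda hU hφ hτ k (hVU hw) (h.left_ne w hw)
    have hd := differentiableOn_hankel hU hφ hτ (k + 2)
    have hopen : IsOpen (V ∩ τ (k + 2) ⁻¹' {0}ᶜ) :=
      (hd.mono hVU).continuousOn.isOpen_inter_preimage h.isOpen isOpen_compl_singleton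
    refine ⟨V ∩ τ (k + 2) ⁻¹' {0}ᶜ, Set.inter_subset_left.trans hVW, ⟨z, hz, fun h0 => hPz ?_⟩,
      (h.mono hopen Set.inter_subset_left).succ (hd.mono fun w hw => hVU hw.1)
        (fun w hw => hw.2) fun w hw => htoda w hw.1⟩
    rw [airyPotential_eq h.isOpen h.right hz (h.right_ne z hz), ← htoda z hz,
      show τ (k + 2) z = 0 from h0]
    simp

lemma hankel_eq_zero_of_eqOn_zero
    (hτ : ∀ m z, τ m z = det (of fun j k : Fin m => iteratedDeriv ((j : ℕ) + (k : ℕ)) φ z))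
    {W : Set ℂ} (hW : IsOpen W) (h0 : Set.EqOn φ 0 W) (k : ℕ) {z : ℂ} (hz : z ∈ W) :
    τ (k + 1) z = 0 := by
  rw [hτ]
  refine det_eq_zero_of_row_eq_zero 0 fun j => ?_
  have := h0.iteratedDeriv_of_isOpen hW (((0 : Fin (k + 1)) : ℕ) + (j : ℕ)) hz
  rw [of_apply, this]
  exact iteratedDeriv_const_zero

end

/-- Airy-type solutions of P_34: if `φ` solves `φ'' + zφ/2 = 0` on an open set `U`, and
`τ_m` is the `m × m` Hankel determinant of derivatives of `φ` (with `τ_0 = 1`), with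
`τ_n` nonvanishing on `U`, then `p_n = −2(log τ_n)'' = −2(τ_n''τ_n − (τ_n')²)/τ_n²`,
assumed nonvanishing on `U`, solves P_34(n − 1/2) on `U`. -/
theorem airy_determinant_solutions_P34 (n : ℕ) (hn : 1 ≤ n) (U : Set ℂ) (hU : IsOpen U)
    (φ : ℂ → ℂ)
    (hφ : ContDiffOn ℂ ⊤ φ U)
    (hairy : ∀ z ∈ U, deriv (deriv φ) z + z / 2 * φ z = 0)
    (τ : ℕ → ℂ → ℂ)
    (hτ0 : ∀ z, τ 0 z = 1)
    (hτ : ∀ m : ℕ, 1 ≤ m → ∀ z,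
      τ m z = Matrix.det (Matrix.of fun j k : Fin m => iteratedDeriv ((j : ℕ) + (k : ℕ)) φ z))
    (hτn0 : ∀ z ∈ U, τ n z ≠ 0)
    (p : ℂ → ℂ)
    (hpdef : ∀ z, p z = -2 * (deriv (deriv (τ n)) z * τ n z - (deriv (τ n) z) ^ 2)
      / (τ n z) ^ 2)
    (hp0 : ∀ z ∈ U, p z ≠ 0) :
    ∀ z ∈ U, DifferentiableAt ℂ p z ∧ DifferentiableAt ℂ (deriv p) z ∧
      deriv (deriv p) z = (deriv p z) ^ 2 / (2 * p z) + 2 * p z ^ 2 - z * p z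
        - (n : ℂ) ^ 2 / (2 * p z) := by
  obtain ⟨k, rfl⟩ : ∃ k, n = k + 1 := ⟨n - 1, by omega⟩
  have hφd : DifferentiableOn ℂ φ U := hφ.differentiableOn (by simp)
  have hτ' := hankel_eq hτ0 hτ
  have hτd := differentiableOn_hankel hU hφd hτ' (k + 1)
  have hpP : ∀ z ∈ U, p z = airyPotential (τ (k + 1)) z := fun z hz => by
    rw [hpdef, airyPotential_eq hU hτd hz (hτn0 z hz)]
  have hPd := differentiableOn_airyPotential hU hτd hτn0
  have hpd : DifferentiableOn ℂ p U := hPd.congr hpP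
  have hp'd := hpd.deriv hU
  have hp''d := hp'd.deriv hU
  have hmain : ∀ z ∈ U, 2 * p z * deriv (deriv p) z -
      (deriv p z ^ 2 + 4 * p z ^ 3 - 2 * z * p z ^ 2 - ((k : ℂ) + 1) ^ 2) = 0 := by
    by_contra! hcon
    obtain ⟨z₀, hz₀, hne⟩ := hcon
    have hcont : ContinuousOn (fun z => 2 * p z * deriv (deriv p) z -
        (deriv p z ^ 2 + 4 * p z ^ 3 - 2 * z * p z ^ 2 - ((k : ℂ) + 1) ^ 2)) U := by
      have h1 := hpd.continuousOn
      have h2 := hp'd.continuousOn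
      have h3 := hp''d.continuousOn
      fun_prop
    have hW := hcont.isOpen_inter_preimage hU (isOpen_compl_singleton (x := 0))
    obtain ⟨z₁, hz₁, hφ₁⟩ : ∃ z ∈ U ∩ (fun z => 2 * p z * deriv (deriv p) z -
        (deriv p z ^ 2 + 4 * p z ^ 3 - 2 * z * p z ^ 2 - ((k : ℂ) + 1) ^ 2)) ⁻¹' {0}ᶜ,
        φ z ≠ 0 := by
      by_contra! h0
      exact hτn0 z₀ hz₀ (hankel_eq_zero_of_eqOn_zero hτ' hW h0 k ⟨hz₀, hne⟩)
    obtain ⟨V, hVW, ⟨z, hz⟩, h⟩ :=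
      exists_airyPair hU hφd hairy hτ' hW Set.inter_subset_left hz₁ hφ₁ k
    obtain ⟨hzU, hznot⟩ := hVW hz
    refine hznot ?_
    have he : p =ᶠ[nhds z] airyPotential (τ (k + 1)) := by
      filter_upwards [hU.mem_nhds hzU] with w hw using hpP w hw
    simp only [Set.mem_singleton_iff]
    rw [he.deriv.deriv_eq, he.deriv_eq, he.eq_of_nhds]
    linear_combination h.painleve hz
  intro z hz
  have hn' := hU.mem_nhds hz
  refine ⟨hpd.differentiableAt hn', hp'd.differentiableAt hn', ?_⟩
  have hpz := hp0 z hz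
  have := hmain z hz
  push_cast
  field_simp
  linear_combination this
end

section
/- Let α ∈ ℂ and let U ⊆ ℂ be open. Suppose q : ℂ → ℂ is twice differentiable on U and satisfies the second Painlevé equation P_II(α): q''(z) = 2 q(z)³ + z q(z) + α for all z ∈ U. Define σ(z) = (q'(z))²/2 − q(z)⁴/2 − z q(z)²/2 − (α + 1/2) q(z) − z²/8. Then σ is twice differentiable on U and satisfies the Jimbo–Miwa–Okamoto equation S_II(α): (σ''(z))² + 4 (σ'(z))³ + 2 σ'(z) (z σ'(z) − σ(z)) = (α + 1/2)²/4 for all z ∈ U. -/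
/-- If `q` solves P_II(α) on an open set `U`, then
`σ = (q')²/2 − q⁴/2 − zq²/2 − (α + 1/2)q − z²/8` is twice differentiable on `U` and
solves the Jimbo–Miwa–Okamoto equation S_II(α). -/
theorem PII_implies_SII (α : ℂ) (U : Set ℂ) (hU : IsOpen U)
    (q : ℂ → ℂ)
    (hq : ∀ z ∈ U, DifferentiableAt ℂ q z)
    (hq' : ∀ z ∈ U, DifferentiableAt ℂ (deriv q) z)
    (hPII : ∀ z ∈ U, deriv (deriv q) z = 2 * q z ^ 3 + z * q z + α)
    (σ : ℂ → ℂ)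
    (hσdef : ∀ z, σ z = (deriv q z) ^ 2 / 2 - q z ^ 4 / 2 - z * q z ^ 2 / 2
      - (α + 1 / 2) * q z - z ^ 2 / 8) :
    ∀ z ∈ U, DifferentiableAt ℂ σ z ∧ DifferentiableAt ℂ (deriv σ) z ∧
      (deriv (deriv σ) z) ^ 2 + 4 * (deriv σ z) ^ 3
        + 2 * deriv σ z * (z * deriv σ z - σ z) = (α + 1 / 2) ^ 2 / 4 := by
  have hσ : ∀ z ∈ U, HasDerivAt σ (-(deriv q z + q z ^ 2 + z / 2) / 2) z := by
    intro z hz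
    have h0 := (hq z hz).hasDerivAt
    have h1 := (hq' z hz).hasDerivAt
    rw [hPII z hz] at h1
    rw [funext hσdef]
    have h := (((((h1.fun_pow 2).div_const 2).fun_sub ((h0.fun_pow 4).div_const 2)).fun_sub
      (((hasDerivAt_id' z).fun_mul (h0.fun_pow 2)).div_const 2)).fun_sub
      (h0.const_mul (α + 1 / 2))).fun_sub (((hasDerivAt_id' z).fun_pow 2).div_const 8)
    refine h.congr_deriv ?_
    norm_num
    ring
  intro z hz
  have hσ' : HasDerivAt (deriv σ)
      (-(2 * q z ^ 3 + z * q z + α + 2 * q z * deriv q z + 1 / 2) / 2) z := by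
    have h0 := (hq z hz).hasDerivAt
    have h1 := (hq' z hz).hasDerivAt
    rw [hPII z hz] at h1
    have h := (((h1.fun_add (h0.fun_pow 2)).fun_add
      ((hasDerivAt_id' z).div_const 2)).fun_neg).div_const 2
    refine (h.congr_of_eventuallyEq ?_).congr_deriv ?_
    · filter_upwards [hU.mem_nhds hz] with w hw using (hσ w hw).deriv
    · norm_num
  refine ⟨(hσ z hz).differentiableAt, hσ'.differentiableAt, ?_⟩
  rw [hσ'.deriv, (hσ z hz).deriv, hσdef z]
  ring
end

section
/- Let U ⊆ ℂ be open and suppose φ : ℂ → ℂ is twice differentiable on U, φ(z) ≠ 0 on U, and φ satisfies φ''(z) + (z/2) φ(z) = 0 for all z ∈ U. Set Φ(z) = −φ'(z)/φ(z) and suppose 2 Φ(z)² + z ≠ 0 on U. Then: (i) p₁(z) = 2 Φ(z)² + z satisfies the Painlevé XXXIV equation P_34(1/2): p₁'' = (p₁')²/(2p₁) + 2p₁² − zp₁ − 1/(2p₁) on U (wherever p₁ ≠ 0); and (ii) q₂(z) = −Φ(z) − 1/(2 Φ(z)² + z) satisfies the second Painlevé equation P_II(3/2): q₂''(z) = 2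 q₂(z)³ + z q₂(z) + 3/2 for all z ∈ U. -/
lemma IsOpen.differentiableAt_deriv_of_hasDerivAt {𝕜 : Type*} [NontriviallyNormedField 𝕜]
    {U : Set 𝕜} (hU : IsOpen U) {f g h : 𝕜 → 𝕜}
    (hf : ∀ z ∈ U, HasDerivAt f (g z) z) (hg : ∀ z ∈ U, HasDerivAt g (h z) z) {z : 𝕜}
    (hz : z ∈ U) :
    DifferentiableAt 𝕜 f z ∧ DifferentiableAt 𝕜 (deriv f) z ∧ deriv f z = g z ∧
      deriv (deriv f) z = h z := by
  have key : HasDerivAt (deriv f) (h z) z := by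
    refine (hg z hz).congr_of_eventuallyEq ?_
    filter_upwards [hU.mem_nhds hz] with w hw using (hf w hw).deriv
  exact ⟨(hf z hz).differentiableAt, key.differentiableAt, (hf z hz).deriv, key.deriv⟩

/-- The negative logarithmic derivative of a solution of `φ'' + zφ/2 = 0` solves the Riccati
equation `Φ' = Φ² + z/2`. -/
lemma hasDerivAt_neg_logDeriv_of_airy {φ : ℂ → ℂ} {z : ℂ} (hφ : DifferentiableAt ℂ φ z)
    (hφ' : DifferentiableAt ℂ (deriv φ) z) (hφ0 : φ z ≠ 0)
    (hairy : deriv (deriv φ) z + z / 2 * φ z = 0) :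
    HasDerivAt (fun w => -deriv φ w / φ w) ((-deriv φ z / φ z) ^ 2 + z / 2) z := by
  refine (hφ'.hasDerivAt.fun_neg.fun_div hφ.hasDerivAt hφ0).congr_deriv ?_
  rw [eq_neg_of_add_eq_zero_left hairy]
  field_simp
  ring


/-- For a nonvanishing solution `φ` of the Airy-type equation `φ'' + zφ/2 = 0` on an open
set `U`, setting `Φ = −φ'/φ` (a solution of the Riccati equation) with `2Φ² + z ≠ 0` on `U`:
(i) `p₁ = 2Φ² + z` solves the Painlevé XXXIV equation P_34(1/2) on `U`, and
(ii) `q₂ = −Φ − 1/(2Φ² + z)` solves the second Painlevé equation P_II(3/2) on `U`. -/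
theorem airy_hierarchy_first_members (U : Set ℂ) (hU : IsOpen U)
    (φ : ℂ → ℂ)
    (hφ : ∀ z ∈ U, DifferentiableAt ℂ φ z)
    (hφ' : ∀ z ∈ U, DifferentiableAt ℂ (deriv φ) z)
    (hφ0 : ∀ z ∈ U, φ z ≠ 0)
    (hairy : ∀ z ∈ U, deriv (deriv φ) z + z / 2 * φ z = 0)
    (Φ : ℂ → ℂ)
    (hΦdef : ∀ z, Φ z = -deriv φ z / φ z)
    (h10 : ∀ z ∈ U, 2 * Φ z ^ 2 + z ≠ 0)
    (p₁ q₂ : ℂ → ℂ)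
    (hp₁def : ∀ z, p₁ z = 2 * Φ z ^ 2 + z)
    (hq₂def : ∀ z, q₂ z = -Φ z - 1 / (2 * Φ z ^ 2 + z)) :
    (∀ z ∈ U, DifferentiableAt ℂ p₁ z ∧ DifferentiableAt ℂ (deriv p₁) z ∧
      deriv (deriv p₁) z = (deriv p₁ z) ^ 2 / (2 * p₁ z) + 2 * p₁ z ^ 2 - z * p₁ z
        - 1 / (2 * p₁ z)) ∧
    (∀ z ∈ U, DifferentiableAt ℂ q₂ z ∧ DifferentiableAt ℂ (deriv q₂) z ∧
      deriv (deriv q₂) z = 2 * q₂ z ^ 3 + z * q₂ z + 3 / 2) := by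
  have hΦ : ∀ z ∈ U, HasDerivAt Φ (Φ z ^ 2 + z / 2) z := fun z hz => by
    rw [hΦdef z, funext hΦdef]
    exact hasDerivAt_neg_logDeriv_of_airy (hφ z hz) (hφ' z hz) (hφ0 z hz) (hairy z hz)
  have hp0 : ∀ z ∈ U, p₁ z ≠ 0 := fun z hz => hp₁def z ▸ h10 z hz
  have hp : ∀ z ∈ U, HasDerivAt p₁ (2 * Φ z * p₁ z + 1) z := fun z hz => by
    rw [hp₁def z, funext hp₁def]
    refine ((((hΦ z hz).fun_pow 2).const_mul 2).fun_add (hasDerivAt_id' z)).congr_deriv ?_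
    push_cast
    ring
  have hp' : ∀ z ∈ U, HasDerivAt (fun w => 2 * Φ w * p₁ w + 1)
      (p₁ z ^ 2 + 2 * Φ z * (2 * Φ z * p₁ z + 1)) z := fun z hz => by
    refine ((((hΦ z hz).const_mul 2).fun_mul (hp z hz)).add_const 1).congr_deriv ?_
    linear_combination -p₁ z * hp₁def z
  have hq : ∀ z ∈ U, HasDerivAt q₂ (-(p₁ z / 2) + (2 * Φ z * p₁ z + 1) / p₁ z ^ 2) z :=
      fun z hz => by
    have hq₂ : q₂ = fun w => -Φ w - (p₁ w)⁻¹ := by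
      funext w
      rw [hq₂def, hp₁def, one_div]
    rw [hq₂]
    refine ((hΦ z hz).fun_neg.fun_sub ((hp z hz).fun_inv (hp0 z hz))).congr_deriv ?_
    linear_combination 1 / 2 * hp₁def z
  have hq' : ∀ z ∈ U, HasDerivAt (fun w => -(p₁ w / 2) + (2 * Φ w * p₁ w + 1) / p₁ w ^ 2)
      (2 * q₂ z ^ 3 + z * q₂ z + 3 / 2) z := fun z hz => by
    have h0 := hp0 z hz
    refine (((hp z hz).div_const 2).fun_neg.fun_add ((hp' z hz).fun_div ((hp z hz).fun_pow 2)
      (pow_ne_zero 2 h0))).congr_deriv ?_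
    have hz' : z = p₁ z - 2 * Φ z ^ 2 := by linear_combination -hp₁def z
    rw [hq₂def, ← hp₁def]
    generalize p₁ z = p at *
    generalize Φ z = a at *
    subst hz'
    push_cast
    field_simp
    ring
  refine ⟨fun z hz => ?_, fun z hz => ?_⟩
  · obtain ⟨h1, h2, h3, h4⟩ := hU.differentiableAt_deriv_of_hasDerivAt hp hp' hz
    refine ⟨h1, h2, ?_⟩
    have h0 := hp0 z hz
    rw [h4, h3]
    field_simp
    linear_combination -2 * p₁ z ^ 2 * hp₁def z
  · obtain ⟨h1, h2, -, h4⟩ := hU.differentiableAt_deriv_of_hasDerivAt hq hq' hz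
    exact ⟨h1, h2, h4⟩
end
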